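/- arXiv:1306.1080 — 12 statements merged into one kernel-verified Lean document; each statement's English description precedes it below -/
import Mathlib

section
/- Let p* ∈ I. Then V_p(x) ≤ V_{p*}(x) holds for all x, p ∈ I if and only if the following two conditions hold: (a) h(p) ≤ h(p*) for every p ∈ I with p < p*, and (b) h is nonincreasing on I ∩ (p*, ∞). (This characterizes optimality of the threshold stopping time τ_{p*} in the optimal stopping problem over all threshold stopping times.) -/
open Set

/-- Threshold value: `V_p(x) = h(p)·ψ(x)` for `x < p` and `g(x)` for `x ≥ p`,
where `h(p) = g(p)/ψ(p)`. -/
noncomputable def Vthr (ψ g : ℝ → ℝ) (p x : ℝ) : ℝ :=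
  if x < p then (g p / ψ p) * ψ x else g x

/-- A continuous function that is antitone to the right of a point stays below its value there. -/
theorem le_of_antitoneOn_inter_Ioi {l r a p : ℝ} {h : ℝ → ℝ} (hc : ContinuousOn h (Ioo l r))
    (ha : a ∈ Ioo l r) (hanti : AntitoneOn h (Ioo l r ∩ Ioi a)) (hp : p ∈ Ioo l r)
    (hap : a < p) : h p ≤ h a := by
  have hcont : ContinuousAt h a := hc.continuousAt (Ioo_mem_nhds ha.1 ha.2)
  refine ge_of_tendsto (hcont.tendsto.mono_left (nhdsWithin_le_nhds (s := Ioi a))) ?_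
  filter_upwards [Ioo_mem_nhdsGT hap] with y hy
  exact hanti ⟨⟨ha.1.trans hy.1, hy.2.trans hp.2⟩, hy.1⟩ ⟨hp, hap⟩ hy.2.le

/-- The threshold stopping time `τ_{p*}` is optimal over all threshold stopping times
(i.e. `V_p(x) ≤ V_{p*}(x)` for all `x, p ∈ I`) iff `h(p) ≤ h(p*)` whenever `p < p*`
and `h` is nonincreasing on `I ∩ (p*, ∞)`. -/
theorem stmt_0 (l r : ℝ) (hlr : l < r) (ψ g : ℝ → ℝ)
    (hψc : ContinuousOn ψ (Ioo l r)) (hψm : StrictMonoOn ψ (Ioo l r))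
    (hψpos : ∀ x ∈ Ioo l r, 0 < ψ x) (hgc : ContinuousOn g (Ioo l r))
    (pstar : ℝ) (hpstar : pstar ∈ Ioo l r) :
    (∀ x ∈ Ioo l r, ∀ p ∈ Ioo l r, Vthr ψ g p x ≤ Vthr ψ g pstar x) ↔
      ((∀ p ∈ Ioo l r, p < pstar → g p / ψ p ≤ g pstar / ψ pstar) ∧
        AntitoneOn (fun p => g p / ψ p) (Ioo l r ∩ Ioi pstar)) := by
  have hc : ContinuousOn (fun p => g p / ψ p) (Ioo l r) :=
    hgc.div hψc fun x hx => (hψpos x hx).ne'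
  constructor
  · intro hV
    refine ⟨fun p hp hpp => ?_, fun x hx p hp hxp => ?_⟩
    · obtain ⟨x, hlx, hxp⟩ := exists_between hp.1
      have hx : x ∈ Ioo l r := ⟨hlx, hxp.trans hp.2⟩
      have hVx := hV x hx p hp
      rw [Vthr, Vthr, if_pos hxp, if_pos (hxp.trans hpp)] at hVx
      exact le_of_mul_le_mul_right hVx (hψpos x hx)
    · rcases hxp.eq_or_lt with rfl | hlt
      · exact le_rfl
      · have hVx := hV x hx.1 p hp.1
        rw [Vthr, Vthr, if_pos hlt, if_neg (not_lt.mpr (le_of_lt hx.2))] at hVx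
        exact (le_div_iff₀ (hψpos x hx.1)).mpr hVx
  · rintro ⟨hbelow, hanti⟩ x hx p hp
    have hψx := hψpos x hx
    have habove : ∀ q ∈ Ioo l r, pstar < q → g q / ψ q ≤ g pstar / ψ pstar := fun q hq hlt =>
      le_of_antitoneOn_inter_Ioi hc hpstar hanti hq hlt
    have hmax : ∀ q ∈ Ioo l r, g q / ψ q ≤ g pstar / ψ pstar := fun q hq => by
      rcases lt_trichotomy q pstar with hlt | rfl | hlt
      · exact hbelow q hq hlt
      · exact le_rfl
      · exact habove q hq hlt
    unfold Vthr
    split_ifs with hxp hxs hxs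
    · exact mul_le_mul_of_nonneg_right (hmax p hp) hψx.le
    · refine (le_div_iff₀ hψx).mp ?_
      rcases (not_lt.mp hxs).eq_or_lt with rfl | hlt
      · exact hmax p hp
      · exact hanti ⟨hx, hlt⟩ ⟨hp, hlt.trans hxp⟩ hxp.le
    · exact (div_le_iff₀ hψx).mp (hmax x hx)
    · exact le_rfl
end

section
/- Assume h is bounded above on I. Then for every x ∈ I, the value function V(x) := sup_{p ∈ I} V_p(x) satisfies V(x) = ψ(x) · max{ h(x), sup{ h(p) : p ∈ I, p > x } }. -/
open Set

/-- If `h = g/ψ` is bounded above on `I`, then for each `x ∈ I` the value function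
`V(x) = sup_{p ∈ I} V_p(x)` equals `ψ(x) · max{h(x), sup{h(p) : p ∈ I, p > x}}`. -/
theorem stmt_1 (l r : ℝ) (hlr : l < r) (ψ g : ℝ → ℝ)
    (hψc : ContinuousOn ψ (Ioo l r)) (hψm : StrictMonoOn ψ (Ioo l r))
    (hψpos : ∀ x ∈ Ioo l r, 0 < ψ x) (hgc : ContinuousOn g (Ioo l r))
    (hbdd : BddAbove ((fun p => g p / ψ p) '' Ioo l r))
    (x : ℝ) (hx : x ∈ Ioo l r) :
    sSup ((fun p => Vthr ψ g p x) '' Ioo l r) =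
      ψ x * max (g x / ψ x) (sSup ((fun p => g p / ψ p) '' (Ioo l r ∩ Ioi x))) := by
  have hψx := hψpos x hx
  have hgx : ψ x * (g x / ψ x) = g x := mul_div_cancel₀ _ hψx.ne'
  have hbdd' : BddAbove ((fun p => g p / ψ p) '' (Ioo l r ∩ Ioi x)) :=
    hbdd.mono (image_mono inter_subset_left)
  have hne : ((fun p => g p / ψ p) '' (Ioo l r ∩ Ioi x)).Nonempty := by
    obtain ⟨p, hxp, hpr⟩ := exists_between hx.2
    exact ⟨_, p, ⟨⟨hx.1.trans hxp, hpr⟩, hxp⟩, rfl⟩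
  refine IsLUB.csSup_eq ⟨?_, fun b hb => ?_⟩ (Set.Nonempty.image _ ⟨x, hx⟩)
  · rintro _ ⟨p, hp, rfl⟩
    by_cases hxp : x < p
    · simp only [Vthr, if_pos hxp]
      rw [mul_comm]
      exact mul_le_mul_of_nonneg_left
        (le_max_of_le_right (le_csSup hbdd' ⟨p, ⟨hp, hxp⟩, rfl⟩)) hψx.le
    · simp only [Vthr, if_neg hxp]
      exact hgx.symm.le.trans (mul_le_mul_of_nonneg_left (le_max_left _ _) hψx.le)
  · rw [← le_div_iff₀' hψx]
    refine max_le ?_ (csSup_le hne ?_)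
    · rw [le_div_iff₀' hψx, hgx]
      simpa [Vthr] using hb ⟨x, hx, rfl⟩
    · rintro _ ⟨p, ⟨hp, hxp⟩, rfl⟩
      rw [le_div_iff₀ hψx]
      simpa only [Vthr, if_pos (mem_Ioi.mp hxp)] using hb ⟨p, hp, rfl⟩
end

section
/- Assume h is bounded above on I and set V(x) := sup_{p ∈ I} V_p(x). Then the continuation set over threshold stopping times satisfies { x ∈ I : V(x) > g(x) } = { x ∈ I : sup{ h(p) : p ∈ I, p > x } > h(x) }, and the stopping set satisfies { x ∈ I : V(x) = g(x) } = { x ∈ I : sup{ h(p) : p ∈ I, p > x } ≤ h(x) }. -/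
open Set

theorem Vthr_self (ψ g : ℝ → ℝ) (x : ℝ) : Vthr ψ g x x = g x :=
  if_neg (lt_irrefl x)

theorem lt_Vthr_iff {ψ g : ℝ → ℝ} {p x : ℝ} (hx : 0 < ψ x) :
    g x < Vthr ψ g p x ↔ x < p ∧ g x / ψ x < g p / ψ p := by
  unfold Vthr
  split_ifs with h
  · simp [h, div_lt_iff₀ hx]
  · simp [h]

theorem bddAbove_image_Vthr {I : Set ℝ} {ψ g : ℝ → ℝ} {x : ℝ} (hxI : x ∈ I) (hx : 0 < ψ x)
    (hbdd : BddAbove ((fun p => g p / ψ p) '' I)) :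
    BddAbove ((fun p => Vthr ψ g p x) '' I) := by
  obtain ⟨M, hM⟩ := hbdd
  rw [mem_upperBounds, forall_mem_image] at hM
  refine ⟨M * ψ x, ?_⟩
  rw [mem_upperBounds, forall_mem_image]
  intro p hp
  unfold Vthr
  split_ifs
  · exact mul_le_mul_of_nonneg_right (hM hp) hx.le
  · exact (div_le_iff₀ hx).1 (hM hxI)

theorem le_sSup_image_Vthr {I : Set ℝ} {ψ g : ℝ → ℝ} {x : ℝ} (hxI : x ∈ I) (hx : 0 < ψ x)
    (hbdd : BddAbove ((fun p => g p / ψ p) '' I)) :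
    g x ≤ sSup ((fun p => Vthr ψ g p x) '' I) :=
  le_csSup (bddAbove_image_Vthr hxI hx hbdd) ⟨x, hxI, Vthr_self ψ g x⟩

theorem lt_sSup_image_Vthr_iff {I : Set ℝ} {ψ g : ℝ → ℝ} {x : ℝ} (hxI : x ∈ I) (hx : 0 < ψ x)
    (hne : (I ∩ Ioi x).Nonempty) (hbdd : BddAbove ((fun p => g p / ψ p) '' I)) :
    g x < sSup ((fun p => Vthr ψ g p x) '' I) ↔
      g x / ψ x < sSup ((fun p => g p / ψ p) '' (I ∩ Ioi x)) := by
  rw [lt_csSup_iff (bddAbove_image_Vthr hxI hx hbdd) (Nonempty.image _ ⟨x, hxI⟩),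
    lt_csSup_iff (hbdd.mono (image_mono inter_subset_left)) (hne.image _),
    exists_mem_image, exists_mem_image]
  simp only [lt_Vthr_iff hx, mem_inter_iff, mem_Ioi, and_assoc]

/-- With `V(x) = sup_{p ∈ I} V_p(x)` (for `h = g/ψ` bounded above on `I`), the
continuation set `{x ∈ I : V(x) > g(x)}` equals `{x ∈ I : sup_{p ∈ I, p > x} h(p) > h(x)}`
and the stopping set `{x ∈ I : V(x) = g(x)}` equals
`{x ∈ I : sup_{p ∈ I, p > x} h(p) ≤ h(x)}`. -/
theorem stmt_2 (l r : ℝ) (hlr : l < r) (ψ g : ℝ → ℝ)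
    (hψc : ContinuousOn ψ (Ioo l r)) (hψm : StrictMonoOn ψ (Ioo l r))
    (hψpos : ∀ x ∈ Ioo l r, 0 < ψ x) (hgc : ContinuousOn g (Ioo l r))
    (hbdd : BddAbove ((fun p => g p / ψ p) '' Ioo l r)) :
    ({x ∈ Ioo l r | g x < sSup ((fun p => Vthr ψ g p x) '' Ioo l r)} =
        {x ∈ Ioo l r | g x / ψ x < sSup ((fun p => g p / ψ p) '' (Ioo l r ∩ Ioi x))}) ∧
      ({x ∈ Ioo l r | sSup ((fun p => Vthr ψ g p x) '' Ioo l r) = g x} =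
        {x ∈ Ioo l r | sSup ((fun p => g p / ψ p) '' (Ioo l r ∩ Ioi x)) ≤ g x / ψ x}) := by
  have key : ∀ x ∈ Ioo l r, (g x < sSup ((fun p => Vthr ψ g p x) '' Ioo l r) ↔
      g x / ψ x < sSup ((fun p => g p / ψ p) '' (Ioo l r ∩ Ioi x))) := by
    intro x hx
    obtain ⟨p, hxp, hpr⟩ := exists_between hx.2
    exact lt_sSup_image_Vthr_iff hx (hψpos x hx) ⟨p, ⟨hx.1.trans hxp, hpr⟩, hxp⟩ hbdd
  refine ⟨?_, ?_⟩ <;> ext x <;> refine and_congr_right fun hx => ?_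
  · exact key x hx
  · rw [← not_lt, ← key x hx, not_lt]
    exact (le_sSup_image_Vthr hx (hψpos x hx) hbdd).ge_iff_eq'.symm
end

section
/- Assume h is bounded above on I, set V(x) := sup_{p ∈ I} V_p(x) and define the continuation set C_th := { x ∈ I : V(x) > g(x) }. Let p* ∈ I. Then C_th = I ∩ (-∞, p*) if and only if the following two conditions hold: (a) h(p) < h(p*) for every p ∈ I with p < p*, and (b) h is nonincreasing on I ∩ (p*, ∞). -/
open Set

lemma bddAbove_Vthr_image {ψ g : ℝ → ℝ} {s : Set ℝ} {x : ℝ} (hx : 0 ≤ ψ x)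
    (hbdd : BddAbove ((fun p => g p / ψ p) '' s)) :
    BddAbove ((fun p => Vthr ψ g p x) '' s) := by
  obtain ⟨M, hM⟩ := hbdd
  refine ⟨max (M * ψ x) (g x), ?_⟩
  rintro _ ⟨p, hp, rfl⟩
  dsimp only [Vthr]
  split_ifs
  · exact le_max_of_le_left (mul_le_mul_of_nonneg_right (hM ⟨p, hp, rfl⟩) hx)
  · exact le_max_right _ _

/-- A point belongs to the continuation set iff the ratio `g / ψ` is larger at some point to its
right. -/
lemma lt_sSup_Vthr_iff {ψ g : ℝ → ℝ} {s : Set ℝ} {x : ℝ} (hxs : x ∈ s) (hx : 0 < ψ x)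
    (hbdd : BddAbove ((fun p => g p / ψ p) '' s)) :
    g x < sSup ((fun p => Vthr ψ g p x) '' s) ↔ ∃ p ∈ s, x < p ∧ g x / ψ x < g p / ψ p := by
  rw [lt_csSup_iff (bddAbove_Vthr_image hx.le hbdd) ⟨_, x, hxs, rfl⟩, exists_mem_image]
  refine exists_congr fun p => and_congr_right fun _ => ?_
  by_cases hxp : x < p
  · simp [Vthr, hxp, div_lt_iff₀ hx]
  · simp [Vthr, hxp]

lemma le_left_endpoint_of_antitoneOn {h : ℝ → ℝ} {l r a : ℝ} (hc : ContinuousOn h (Ioo l r))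
    (ha : a ∈ Ioo l r) (hanti : AntitoneOn h (Ioo l r ∩ Ioi a)) {p : ℝ} (hp : p ∈ Ioo l r)
    (hap : a < p) : h p ≤ h a := by
  have ht : Filter.Tendsto h (nhdsWithin a (Ioi a)) (nhds (h a)) :=
    (hc.continuousAt (Ioo_mem_nhds ha.1 ha.2)).tendsto.mono_left nhdsWithin_le_nhds
  refine ge_of_tendsto ht ?_
  filter_upwards [Ioo_mem_nhdsGT hap] with q hq
  exact hanti ⟨⟨ha.1.trans hq.1, hq.2.trans hp.2⟩, hq.1⟩ ⟨hp, hap⟩ hq.2.le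

/-- If every point left of `a` is exceeded by `h` further to the right, and `h a` is not exceeded
to the right of `a`, then `h` is strictly below `h a` to the left of `a`. -/
lemma lt_of_exists_gt_of_le {h : ℝ → ℝ} {l r a : ℝ} (hc : ContinuousOn h (Ioo l r))
    (ha : a ∈ Ioo l r) (hleft : ∀ x ∈ Ioo l r, x < a → ∃ q ∈ Ioo l r, x < q ∧ h x < h q)
    (hright : ∀ q ∈ Ioo l r, a < q → h q ≤ h a) {p : ℝ} (hp : p ∈ Ioo l r) (hpa : p < a) :
    h p < h a := by
  by_contra! hle
  obtain ⟨m, hm, hmax⟩ := isCompact_Icc.exists_isMaxOn (nonempty_Icc.2 hpa.le)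
    (hc.mono (Icc_subset_Ioo hp.1 ha.2))
  obtain ⟨n, hn, hna, hnmax⟩ : ∃ n ∈ Icc p a, n < a ∧ ∀ q ∈ Icc p a, h q ≤ h n := by
    rcases hm.2.lt_or_eq with hma | rfl
    · exact ⟨m, hm, hma, fun q hq => hmax hq⟩
    · exact ⟨p, left_mem_Icc.2 hpa.le, hpa, fun q hq => (hmax hq).trans hle⟩
  obtain ⟨q, hq, hnq, hlt⟩ := hleft n ⟨hp.1.trans_le hn.1, hna.trans ha.2⟩ hna
  rcases le_or_gt q a with hqa | hqa
  · exact hlt.not_ge (hnmax q ⟨hn.1.trans hnq.le, hqa⟩)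
  · exact hlt.not_ge ((hright q hq hqa).trans (hnmax a (right_mem_Icc.2 hpa.le)))

/-- The continuation set `C_th = {x ∈ I : V(x) > g(x)}` over threshold stopping
times equals `I ∩ (-∞, p*)` iff `h(p) < h(p*)` whenever `p < p*` and
`h` is nonincreasing on `I ∩ (p*, ∞)`. -/
theorem stmt_3 (l r : ℝ) (hlr : l < r) (ψ g : ℝ → ℝ)
    (hψc : ContinuousOn ψ (Ioo l r)) (hψm : StrictMonoOn ψ (Ioo l r))
    (hψpos : ∀ x ∈ Ioo l r, 0 < ψ x) (hgc : ContinuousOn g (Ioo l r))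
    (hbdd : BddAbove ((fun p => g p / ψ p) '' Ioo l r))
    (pstar : ℝ) (hpstar : pstar ∈ Ioo l r) :
    ({x ∈ Ioo l r | g x < sSup ((fun p => Vthr ψ g p x) '' Ioo l r)} =
        Ioo l r ∩ Iio pstar) ↔
      ((∀ p ∈ Ioo l r, p < pstar → g p / ψ p < g pstar / ψ pstar) ∧
        AntitoneOn (fun p => g p / ψ p) (Ioo l r ∩ Ioi pstar)) := by
  have hc : ContinuousOn (fun p => g p / ψ p) (Ioo l r) :=
    hgc.div hψc fun x hx => (hψpos x hx).ne'
  have key : ∀ x ∈ Ioo l r, (g x < sSup ((fun p => Vthr ψ g p x) '' Ioo l r) ↔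
      ∃ p ∈ Ioo l r, x < p ∧ g x / ψ x < g p / ψ p) :=
    fun x hx => lt_sSup_Vthr_iff hx (hψpos x hx) hbdd
  constructor
  · intro heq
    have hmem : ∀ x ∈ Ioo l r, ((∃ p ∈ Ioo l r, x < p ∧ g x / ψ x < g p / ψ p) ↔ x < pstar) := by
      intro x hx
      rw [← key x hx]
      simpa only [mem_ofPred_eq, mem_inter_iff, mem_Iio, hx, true_and] using Set.ext_iff.1 heq x
    have hright : ∀ x ∈ Ioo l r, pstar ≤ x → ∀ q ∈ Ioo l r, x < q →
        g q / ψ q ≤ g x / ψ x := by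
      intro x hx hpx q hq hxq
      by_contra! hlt
      exact hpx.not_gt ((hmem x hx).1 ⟨q, hq, hxq, hlt⟩)
    refine ⟨fun p hp hlt => lt_of_exists_gt_of_le hc hpstar (fun x hx => (hmem x hx).2)
      (hright pstar hpstar le_rfl) hp hlt, fun x hx y hy hxy => ?_⟩
    rcases hxy.eq_or_lt with rfl | hxy
    · exact le_rfl
    · exact hright x hx.1 (le_of_lt hx.2) y hy.1 hxy
  · rintro ⟨hlt, hanti⟩
    ext x
    refine and_congr_right fun hx => (key x hx).trans ⟨?_, fun hxp =>
      ⟨pstar, hpstar, hxp, hlt x hx hxp⟩⟩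
    rintro ⟨p, hp, hxp, hh⟩
    by_contra hnot
    rw [mem_Iio] at hnot
    rcases (not_lt.1 hnot).eq_or_lt with rfl | hpx
    · exact hh.not_ge (le_left_endpoint_of_antitoneOn hc hx hanti hp hxp)
    · exact hh.not_ge (hanti ⟨hx, hpx⟩ ⟨hp, hpx.trans hxp⟩ hxp.le)
end

section
/- Let p* ∈ I be such that h(p) ≤ h(p*) for all p ∈ I (i.e., the threshold stopping time τ_{p*} is optimal over all threshold stopping times), and suppose g and ψ are differentiable at p*. Then the function V_{p*} (equal to h(p*)·ψ(x) for x < p* and to g(x) for x ≥ p*) is differentiable at p* and V_{p*}'(p*) = g'(p*) (smooth pasting). -/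
open Set

/-- Smooth pasting: if `h(p) ≤ h(p*)` for all `p ∈ I` (optimality of `τ_{p*}` over
threshold stopping times) and `g`, `ψ` are differentiable at `p*`, then `V_{p*}` is
differentiable at `p*` and `V_{p*}'(p*) = g'(p*)`. -/
theorem stmt_4 (l r : ℝ) (hlr : l < r) (ψ g : ℝ → ℝ)
    (hψc : ContinuousOn ψ (Ioo l r)) (hψm : StrictMonoOn ψ (Ioo l r))
    (hψpos : ∀ x ∈ Ioo l r, 0 < ψ x) (hgc : ContinuousOn g (Ioo l r))
    (pstar : ℝ) (hpstar : pstar ∈ Ioo l r)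
    (hopt : ∀ p ∈ Ioo l r, g p / ψ p ≤ g pstar / ψ pstar)
    (hgd : DifferentiableAt ℝ g pstar) (hψd : DifferentiableAt ℝ ψ pstar) :
    DifferentiableAt ℝ (Vthr ψ g pstar) pstar ∧
      deriv (Vthr ψ g pstar) pstar = deriv g pstar := by
  have hpos := hψpos pstar hpstar
  set c := g pstar / ψ pstar
  have hcg : c * ψ pstar = g pstar := div_mul_cancel₀ _ hpos.ne'
  have hψ' := hψd.hasDerivAt.const_mul c
  have hmax : IsLocalMax (fun x => g x - c * ψ x) pstar := by
    filter_upwards [Ioo_mem_nhds hpstar.1 hpstar.2] with x hx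
    have := (div_le_iff₀ (hψpos x hx)).mp (hopt x hx)
    linarith
  have hderiv : deriv g pstar - c * deriv ψ pstar = 0 :=
    hmax.hasDerivAt_eq_zero (hgd.hasDerivAt.sub hψ')
  rw [← sub_eq_zero.mp hderiv] at hψ'
  have hVp : Vthr ψ g pstar pstar = g pstar := by simp [Vthr]
  have hleft : HasDerivWithinAt (Vthr ψ g pstar) (deriv g pstar) (Iio pstar) pstar :=
    hψ'.hasDerivWithinAt.congr (fun x hx => if_pos hx) (hVp.trans hcg.symm)
  have hright : HasDerivWithinAt (Vthr ψ g pstar) (deriv g pstar) (Ici pstar) pstar :=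
    hgd.hasDerivAt.hasDerivWithinAt.congr (fun x hx => if_neg (not_lt.mpr hx)) hVp
  have hV : HasDerivAt (Vthr ψ g pstar) (deriv g pstar) pstar := by
    simpa only [Iio_union_Ici, hasDerivWithinAt_univ] using hleft.union hright
  exact ⟨hV.differentiableAt, hV.deriv⟩
end

section
/- Let p* ∈ I be such that h(p) ≤ h(p*) for all p ∈ I, suppose ψ is differentiable at p*, and suppose g has one-sided derivatives g'(p*−0) and g'(p*+0) at p*. Then the function V := V_{p*} has one-sided derivatives at p* with V'(p*−0) = h(p*)·ψ'(p*) and V'(p*+0) = g'(p*+0), and the inequalities g'(p*+0) = V'(p*+0) ≤ V'(p*−0) ≤ g'(p*−0) hold. -/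
open Set

open Filter Topology in
theorem HasDerivWithinAt.nonpos_of_eventually_le_right {f : ℝ → ℝ} {f' a : ℝ}
    (hf : HasDerivWithinAt f f' (Ici a) a) (hle : ∀ᶠ x in 𝓝[>] a, f x ≤ f a) : f' ≤ 0 := by
  have hlim := (hasDerivWithinAt_iff_tendsto_slope' self_notMem_Ioi).1 hf.Ioi_of_Ici
  refine le_of_tendsto hlim ?_
  filter_upwards [hle, self_mem_nhdsWithin] with x hx hax
  rw [slope_def_field]
  exact div_nonpos_of_nonpos_of_nonneg (sub_nonpos.2 hx) (sub_nonneg.2 (le_of_lt hax))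

open Filter Topology in
theorem HasDerivWithinAt.nonneg_of_eventually_le_left {f : ℝ → ℝ} {f' a : ℝ}
    (hf : HasDerivWithinAt f f' (Iic a) a) (hle : ∀ᶠ x in 𝓝[<] a, f x ≤ f a) : 0 ≤ f' := by
  have hlim := (hasDerivWithinAt_iff_tendsto_slope' self_notMem_Iio).1 hf.Iio_of_Iic
  refine ge_of_tendsto hlim ?_
  filter_upwards [hle, self_mem_nhdsWithin] with x hx hxa
  rw [slope_def_field]
  exact div_nonneg_of_nonpos (sub_nonpos.2 hx) (sub_nonpos.2 (le_of_lt hxa))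

/-- If `h(p) ≤ h(p*)` for all `p ∈ I`, `ψ` is differentiable at `p*` and `g` has
one-sided derivatives `g'(p*−0)`, `g'(p*+0)` at `p*`, then `V = V_{p*}` has one-sided
derivatives at `p*` with `V'(p*−0) = h(p*)·ψ'(p*)`, `V'(p*+0) = g'(p*+0)`, and
`g'(p*+0) = V'(p*+0) ≤ V'(p*−0) ≤ g'(p*−0)`. -/
theorem stmt_5 (l r : ℝ) (hlr : l < r) (ψ g : ℝ → ℝ)
    (hψc : ContinuousOn ψ (Ioo l r)) (hψm : StrictMonoOn ψ (Ioo l r))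
    (hψpos : ∀ x ∈ Ioo l r, 0 < ψ x) (hgc : ContinuousOn g (Ioo l r))
    (pstar : ℝ) (hpstar : pstar ∈ Ioo l r)
    (hopt : ∀ p ∈ Ioo l r, g p / ψ p ≤ g pstar / ψ pstar)
    (dψ : ℝ) (hψd : HasDerivAt ψ dψ pstar)
    (gl gr : ℝ)
    (hgl : HasDerivWithinAt g gl (Iic pstar) pstar)
    (hgr : HasDerivWithinAt g gr (Ici pstar) pstar) :
    HasDerivWithinAt (Vthr ψ g pstar) ((g pstar / ψ pstar) * dψ) (Iic pstar) pstar ∧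
      HasDerivWithinAt (Vthr ψ g pstar) gr (Ici pstar) pstar ∧
      gr ≤ (g pstar / ψ pstar) * dψ ∧ (g pstar / ψ pstar) * dψ ≤ gl := by
  have hne : ψ pstar ≠ 0 := (hψpos pstar hpstar).ne'
  have hcancel : g pstar / ψ pstar * ψ pstar = g pstar := div_mul_cancel₀ _ hne
  have hψh : HasDerivAt (fun x => g pstar / ψ pstar * ψ x) (g pstar / ψ pstar * dψ) pstar :=
    hψd.const_mul _
  have hmax : ∀ᶠ x in nhds pstar, g x - g pstar / ψ pstar * ψ x ≤
      g pstar - g pstar / ψ pstar * ψ pstar := by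
    filter_upwards [Ioo_mem_nhds hpstar.1 hpstar.2] with x hx
    have := (div_le_iff₀ (hψpos x hx)).1 (hopt x hx)
    linarith
  refine ⟨?_, ?_, ?_, ?_⟩
  · refine hψh.hasDerivWithinAt.congr_of_mem (fun x hx => ?_) self_mem_Iic
    rcases (mem_Iic.1 hx).lt_or_eq with h | rfl
    · simp [Vthr, h]
    · simp [Vthr, hcancel]
  · refine hgr.congr_of_mem (fun x hx => ?_) self_mem_Ici
    simp [Vthr, not_lt.2 (mem_Ici.1 hx)]
  · exact sub_nonpos.1 ((hgr.sub hψh.hasDerivWithinAt).nonpos_of_eventually_le_right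
      (hmax.filter_mono nhdsWithin_le_nhds))
  · exact sub_nonneg.1 ((hgl.sub hψh.hasDerivWithinAt).nonneg_of_eventually_le_left
      (hmax.filter_mono nhdsWithin_le_nhds))
end

section
/- Let p* ∈ I, suppose g and ψ are differentiable on a neighborhood of p* with their derivatives differentiable at p*, and suppose that V_p(x) ≤ V_{p*}(x) for all x, p ∈ I (i.e., V_{p*} is the value function of the optimal stopping problem over threshold stopping times). Then g''(p*) ≤ h(p*)·ψ''(p*); that is, for the free-boundary solution U(x) = h(p*)·ψ(x) one has U''(p*) ≥ g''(p*). -/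
open Set Filter

/-- At an interior local maximum the second derivative is nonpositive. -/
lemma IsLocalMax.deriv_deriv_nonpos {f : ℝ → ℝ} {a : ℝ} (h : IsLocalMax f a)
    (hc : ContinuousAt f a) : deriv (deriv f) a ≤ 0 := by
  by_contra! hpos
  have hmin : IsLocalMin f a := isLocalMin_of_deriv_deriv_pos hpos h.deriv_eq_zero hc
  have hconst : f =ᶠ[nhds a] fun _ => f a := by
    filter_upwards [h, hmin] with x h₁ h₂ using le_antisymm h₁ h₂
  have hzero : deriv (deriv f) a = 0 := by
    rw [hconst.deriv.deriv_eq]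
    simp
  exact hpos.ne' hzero

/-- If the threshold `q` is optimal, then `h(p) ≤ h(q)` for every threshold `p`. -/
lemma div_le_div_of_Vthr_le {l r : ℝ} {ψ g : ℝ → ℝ} (hψpos : ∀ x ∈ Ioo l r, 0 < ψ x)
    {q : ℝ} (hq : q ∈ Ioo l r)
    (hopt : ∀ x ∈ Ioo l r, ∀ p ∈ Ioo l r, Vthr ψ g p x ≤ Vthr ψ g q x)
    {p : ℝ} (hp : p ∈ Ioo l r) : g p / ψ p ≤ g q / ψ q := by
  obtain ⟨x, hlx, hx⟩ := exists_between (lt_min hp.1 hq.1)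
  obtain ⟨hxp, hxq⟩ := lt_min_iff.mp hx
  have hxI : x ∈ Ioo l r := ⟨hlx, hxp.trans hp.2⟩
  have hV := hopt x hxI p hp
  simp only [Vthr, if_pos hxp, if_pos hxq] at hV
  exact le_of_mul_le_mul_right hV (hψpos x hxI)

/-- Second-order necessary condition: if `V_{p*}` is the value function over threshold
stopping times (`V_p(x) ≤ V_{p*}(x)` for all `x, p ∈ I`) and `g`, `ψ` are differentiable
near `p*` with derivatives differentiable at `p*`, then `g''(p*) ≤ h(p*)·ψ''(p*)`,
i.e. `U''(p*) ≥ g''(p*)` for `U(x) = h(p*)·ψ(x)`. -/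
theorem stmt_8 (l r : ℝ) (hlr : l < r) (ψ g : ℝ → ℝ)
    (hψc : ContinuousOn ψ (Ioo l r)) (hψm : StrictMonoOn ψ (Ioo l r))
    (hψpos : ∀ x ∈ Ioo l r, 0 < ψ x) (hgc : ContinuousOn g (Ioo l r))
    (pstar : ℝ) (hpstar : pstar ∈ Ioo l r)
    (hgd : ∀ᶠ x in nhds pstar, DifferentiableAt ℝ g x)
    (hψd : ∀ᶠ x in nhds pstar, DifferentiableAt ℝ ψ x)
    (hgd2 : DifferentiableAt ℝ (deriv g) pstar)
    (hψd2 : DifferentiableAt ℝ (deriv ψ) pstar)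
    (hopt : ∀ x ∈ Ioo l r, ∀ p ∈ Ioo l r, Vthr ψ g p x ≤ Vthr ψ g pstar x) :
    deriv (deriv g) pstar ≤ (g pstar / ψ pstar) * deriv (deriv ψ) pstar := by
  set c := g pstar / ψ pstar
  have hmax : IsLocalMax (fun x => g x - c * ψ x) pstar := by
    filter_upwards [Ioo_mem_nhds hpstar.1 hpstar.2] with p hp
    have hle : g p ≤ c * ψ p :=
      (div_le_iff₀ (hψpos p hp)).mp (div_le_div_of_Vthr_le hψpos hpstar hopt hp)
    have heq : c * ψ pstar = g pstar := div_mul_cancel₀ _ (hψpos pstar hpstar).ne'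
    linarith
  have hderiv : deriv (fun x => g x - c * ψ x) =ᶠ[nhds pstar]
      fun x => deriv g x - c * deriv ψ x := by
    filter_upwards [hgd, hψd] with x hgx hψx
    exact (hgx.hasDerivAt.sub (hψx.hasDerivAt.const_mul c)).deriv
  have hderiv₂ : deriv (deriv fun x => g x - c * ψ x) pstar =
      deriv (deriv g) pstar - c * deriv (deriv ψ) pstar := by
    rw [hderiv.deriv_eq]
    exact (hgd2.hasDerivAt.sub (hψd2.hasDerivAt.const_mul c)).deriv
  have hcont : ContinuousAt (fun x => g x - c * ψ x) pstar :=
    hgd.self_of_nhds.continuousAt.sub (hψd.self_of_nhds.continuousAt.const_mul c)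
  have hnonpos := hmax.deriv_deriv_nonpos hcont
  linarith
end

section
/- Let p* ∈ I, suppose g and ψ are differentiable on a neighborhood of p* with their derivatives differentiable at p*, suppose h'(p*) = 0, and suppose g''(p*) < h(p*)·ψ''(p*) (i.e., U''(p*) > g''(p*) for the free-boundary solution U(x) = h(p*)·ψ(x)). Then for every x ∈ I with x < p*, the function p ↦ V_p(x) has a strict local maximum at p = p*. -/
open Set Filter

/-- The strict form of the second-derivative test: a nondegenerate critical point with negative
second derivative is a strict local maximum. -/
theorem eventually_lt_of_deriv_deriv_neg {f : ℝ → ℝ} {a : ℝ} (hf : deriv (deriv f) a < 0)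
    (hd : deriv f a = 0) (hc : ContinuousAt f a) :
    ∀ᶠ x in nhdsWithin a {a}ᶜ, f x < f a := by
  have hsign := eventually_nhdsWithin_sign_eq_of_deriv_neg hf hd
  obtain ⟨ε, hε, hball⟩ := Metric.eventually_nhds_iff.mp hsign
  have hderiv : ∀ y, |y - a| < ε → SignType.sign (deriv f y) = SignType.sign (a - y) :=
    fun y hy => hball (by rwa [Real.dist_eq])
  have hcont : ∀ y, |y - a| < ε → ContinuousAt f y := by
    intro y hy
    rcases eq_or_ne y a with rfl | hne
    · exact hc
    · refine (differentiableAt_of_deriv_ne_zero ?_).continuousAt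
      rw [← sign_ne_zero, hderiv y hy, sign_ne_zero]
      exact sub_ne_zero.mpr hne.symm
  filter_upwards [self_mem_nhdsWithin, nhdsWithin_le_nhds (Metric.ball_mem_nhds a hε)]
    with x hxa hx
  rw [Metric.mem_ball, Real.dist_eq, abs_lt] at hx
  rcases lt_or_gt_of_ne (show x ≠ a from hxa) with hlt | hgt
  · refine strictMonoOn_of_deriv_pos (convex_Icc x a) (fun y hy => ?_) (fun y hy => ?_)
      (left_mem_Icc.mpr hlt.le) (right_mem_Icc.mpr hlt.le) hlt
    · exact (hcont y (abs_lt.mpr ⟨by linarith [hy.1], by linarith [hy.2]⟩)).continuousWithinAt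
    · rw [interior_Icc] at hy
      rw [← sign_eq_one_iff, hderiv y (abs_lt.mpr ⟨by linarith [hy.1], by linarith [hy.2]⟩),
        sign_eq_one_iff]
      exact sub_pos.mpr hy.2
  · refine strictAntiOn_of_deriv_neg (convex_Icc a x) (fun y hy => ?_) (fun y hy => ?_)
      (left_mem_Icc.mpr hgt.le) (right_mem_Icc.mpr hgt.le) hgt
    · exact (hcont y (abs_lt.mpr ⟨by linarith [hy.1], by linarith [hy.2]⟩)).continuousWithinAt
    · rw [interior_Icc] at hy
      rw [← sign_eq_neg_one_iff, hderiv y (abs_lt.mpr ⟨by linarith [hy.1], by linarith [hy.2]⟩),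
        sign_eq_neg_one_iff]
      exact sub_neg.mpr hy.1

/-- At a critical point of `g / ψ`, the derivatives of `g` and `ψ` have the same ratio as `g` and
`ψ` themselves. -/
theorem deriv_eq_div_mul_deriv_of_deriv_div_eq_zero {g ψ : ℝ → ℝ} {a : ℝ}
    (hg : DifferentiableAt ℝ g a) (hψ : DifferentiableAt ℝ ψ a) (hne : ψ a ≠ 0)
    (h : deriv (fun p => g p / ψ p) a = 0) : deriv g a = g a / ψ a * deriv ψ a := by
  rw [deriv_fun_div hg hψ hne, div_eq_zero_iff, or_iff_left (pow_ne_zero 2 hne)] at h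
  field_simp
  linarith

/-- Second-order sufficient condition: if `h'(p*) = 0` and
`g''(p*) < h(p*)·ψ''(p*)` (i.e. `U''(p*) > g''(p*)` for `U(x) = h(p*)·ψ(x)`), then
for every `x ∈ I` with `x < p*`, the map `p ↦ V_p(x)` has a strict local maximum
at `p = p*`. -/
theorem stmt_9 (l r : ℝ) (hlr : l < r) (ψ g : ℝ → ℝ)
    (hψc : ContinuousOn ψ (Ioo l r)) (hψm : StrictMonoOn ψ (Ioo l r))
    (hψpos : ∀ x ∈ Ioo l r, 0 < ψ x) (hgc : ContinuousOn g (Ioo l r))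
    (pstar : ℝ) (hpstar : pstar ∈ Ioo l r)
    (hgd : ∀ᶠ x in nhds pstar, DifferentiableAt ℝ g x)
    (hψd : ∀ᶠ x in nhds pstar, DifferentiableAt ℝ ψ x)
    (hgd2 : DifferentiableAt ℝ (deriv g) pstar)
    (hψd2 : DifferentiableAt ℝ (deriv ψ) pstar)
    (hstat : deriv (fun p => g p / ψ p) pstar = 0)
    (hsec : deriv (deriv g) pstar < (g pstar / ψ pstar) * deriv (deriv ψ) pstar) :
    ∀ x ∈ Ioo l r, x < pstar →
      ∀ᶠ p in nhdsWithin pstar {pstar}ᶜ, Vthr ψ g p x < Vthr ψ g pstar x := by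
  intro x hx hxp
  have hψp := hψpos pstar hpstar
  set c := g pstar / ψ pstar with hc
  have hf_deriv : deriv (fun p => g p - c * ψ p) =ᶠ[nhds pstar]
      fun p => deriv g p - c * deriv ψ p := by
    filter_upwards [hgd, hψd] with p hgp hψp
    rw [deriv_fun_sub hgp (hψp.const_mul c), deriv_const_mul c hψp]
  have hmax : ∀ᶠ p in nhdsWithin pstar {pstar}ᶜ, g p - c * ψ p < g pstar - c * ψ pstar := by
    refine eventually_lt_of_deriv_deriv_neg (f := fun p => g p - c * ψ p) ?_ ?_ ?_
    · rw [hf_deriv.deriv_eq, deriv_fun_sub hgd2 (hψd2.const_mul c), deriv_const_mul c hψd2]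
      exact sub_neg.mpr hsec
    · rw [hf_deriv.eq_of_nhds]
      exact sub_eq_zero.mpr (deriv_eq_div_mul_deriv_of_deriv_div_eq_zero hgd.self_of_nhds
        hψd.self_of_nhds hψp.ne' hstat)
    · exact hgd.self_of_nhds.continuousAt.sub (hψd.self_of_nhds.continuousAt.const_mul c)
  have hzero : g pstar - c * ψ pstar = 0 := by
    rw [hc, div_mul_cancel₀ _ hψp.ne', sub_self]
  filter_upwards [hmax, nhdsWithin_le_nhds (Ioo_mem_nhds hxp hpstar.2)] with p hp hpI
  have hlt : g p / ψ p < c := by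
    rw [div_lt_iff₀ (hψpos p ⟨hx.1.trans hpI.1, hpI.2⟩)]
    linarith
  rw [Vthr, Vthr, if_pos hpI.1, if_pos hxp]
  exact mul_lt_mul_of_pos_right hlt (hψpos x hx)
end

section
/- Let p* ∈ I, suppose g and ψ are differentiable on a neighborhood of p* with their derivatives differentiable at p*, suppose h'(p*) = 0, and suppose g''(p*) > h(p*)·ψ''(p*) (i.e., U''(p*) < g''(p*) for the free-boundary solution U(x) = h(p*)·ψ(x)). Then for every x ∈ I with x < p*, the function p ↦ V_p(x) has a strict local minimum at p = p*; in particular, the pair (U, p*) cannot solve the optimal stopping problem over threshold stopping times. -/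
open Set Filter

/-- The second-derivative test in its strict form. -/
theorem eventually_lt_of_deriv_deriv_pos {f : ℝ → ℝ} {a : ℝ}
    (hf : ∀ᶠ x in nhds a, DifferentiableAt ℝ f x)
    (h₁ : deriv f a = 0) (h₂ : 0 < deriv (deriv f) a) :
    ∀ᶠ x in nhdsWithin a {a}ᶜ, f a < f x := by
  set ε := deriv (deriv f) a / 4 with hε
  have hquad : ∀ x, HasDerivAt (fun y => ε * (y - a) ^ 2) (ε * (2 * (x - a))) x := fun x => by
    simpa using (((hasDerivAt_id x).sub_const a).pow 2).const_mul ε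
  have hderiv : deriv (fun x => f x - ε * (x - a) ^ 2) =ᶠ[nhds a]
      fun x => deriv f x - ε * (2 * (x - a)) := by
    filter_upwards [hf] with x hx
    exact (hx.hasDerivAt.sub (hquad x)).deriv
  have hlin : HasDerivAt (fun x => ε * (2 * (x - a))) (ε * 2) a := by
    simpa using (((hasDerivAt_id a).sub_const a).const_mul 2).const_mul ε
  have hdd : deriv (deriv (fun x => f x - ε * (x - a) ^ 2)) a
      = deriv (deriv f) a - ε * 2 := by
    rw [hderiv.deriv_eq]
    exact ((differentiableAt_of_deriv_ne_zero h₂.ne').hasDerivAt.sub hlin).deriv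
  have hmin : IsLocalMin (fun x => f x - ε * (x - a) ^ 2) a := by
    refine isLocalMin_of_deriv_deriv_pos ?_ ?_ ?_
    · rw [hdd]; linarith
    · simp [hderiv.self_of_nhds, h₁]
    · exact (hf.self_of_nhds.hasDerivAt.sub (hquad a)).continuousAt
  filter_upwards [nhdsWithin_le_nhds hmin, self_mem_nhdsWithin] with x hx hxa
  have hpos : 0 < ε * (x - a) ^ 2 := by
    have := sub_ne_zero.mpr hxa
    positivity
  simp only [sub_self] at hx
  linarith

/-- If `h'(p*) = 0` and `g''(p*) > h(p*)·ψ''(p*)` (i.e. `U''(p*) < g''(p*)` for the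
free-boundary solution `U(x) = h(p*)·ψ(x)`), then for every `x ∈ I` with `x < p*`
the map `p ↦ V_p(x)` has a strict local minimum at `p = p*`; in particular `(U, p*)`
cannot solve the optimal stopping problem over threshold stopping times. -/
theorem stmt_10 (l r : ℝ) (hlr : l < r) (ψ g : ℝ → ℝ)
    (hψc : ContinuousOn ψ (Ioo l r)) (hψm : StrictMonoOn ψ (Ioo l r))
    (hψpos : ∀ x ∈ Ioo l r, 0 < ψ x) (hgc : ContinuousOn g (Ioo l r))
    (pstar : ℝ) (hpstar : pstar ∈ Ioo l r)
    (hgd : ∀ᶠ x in nhds pstar, DifferentiableAt ℝ g x)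
    (hψd : ∀ᶠ x in nhds pstar, DifferentiableAt ℝ ψ x)
    (hgd2 : DifferentiableAt ℝ (deriv g) pstar)
    (hψd2 : DifferentiableAt ℝ (deriv ψ) pstar)
    (hstat : deriv (fun p => g p / ψ p) pstar = 0)
    (hsec : (g pstar / ψ pstar) * deriv (deriv ψ) pstar < deriv (deriv g) pstar) :
    (∀ x ∈ Ioo l r, x < pstar →
        ∀ᶠ p in nhdsWithin pstar {pstar}ᶜ, Vthr ψ g pstar x < Vthr ψ g p x) ∧
      ¬ (∀ x ∈ Ioo l r, ∀ p ∈ Ioo l r, Vthr ψ g p x ≤ Vthr ψ g pstar x) := by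
  have hψ0 : 0 < ψ pstar := hψpos _ hpstar
  have hg' := hgd.self_of_nhds.hasDerivAt
  have hψ' := hψd.self_of_nhds.hasDerivAt
  set c := g pstar / ψ pstar with hc
  have hgc0 : g pstar = c * ψ pstar := by rw [hc]; field_simp
  have hfirst : deriv g pstar = c * deriv ψ pstar := by
    have h := (hg'.div hψ' hψ0.ne').deriv.symm.trans hstat
    rw [div_eq_zero_iff, or_iff_left (pow_ne_zero 2 hψ0.ne'), hgc0] at h
    refine mul_right_cancel₀ hψ0.ne' ?_
    linarith
  have hderiv : deriv (fun p => g p - c * ψ p) =ᶠ[nhds pstar]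
      fun p => deriv g p - c * deriv ψ p := by
    filter_upwards [hgd, hψd] with p hp hq
    exact (hp.hasDerivAt.sub (hq.hasDerivAt.const_mul c)).deriv
  have hgap : ∀ᶠ p in nhdsWithin pstar {pstar}ᶜ, c * ψ p < g p := by
    have h := eventually_lt_of_deriv_deriv_pos (f := fun p => g p - c * ψ p) (a := pstar)
      (by filter_upwards [hgd, hψd] with p hp hq using hp.sub (hq.const_mul c))
      (by simp [hderiv.self_of_nhds, hfirst])
      (by
        have hdd : deriv (fun p => deriv g p - c * deriv ψ p) pstar
            = deriv (deriv g) pstar - c * deriv (deriv ψ) pstar :=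
          (hgd2.hasDerivAt.sub (hψd2.hasDerivAt.const_mul c)).deriv
        rw [hderiv.deriv_eq, hdd]
        linarith)
    filter_upwards [h] with p hp
    linarith
  have hstrict : ∀ x ∈ Ioo l r, x < pstar →
      ∀ᶠ p in nhdsWithin pstar {pstar}ᶜ, p ∈ Ioo l r ∧ Vthr ψ g pstar x < Vthr ψ g p x := by
    intro x hx hxp
    filter_upwards [hgap, nhdsWithin_le_nhds (Ioo_mem_nhds hpstar.1 hpstar.2),
      nhdsWithin_le_nhds (Ioi_mem_nhds hxp)] with p hp hpI hpx
    refine ⟨hpI, ?_⟩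
    rw [Vthr, Vthr, if_pos hxp, if_pos (mem_Ioi.mp hpx)]
    exact mul_lt_mul_of_pos_right ((lt_div_iff₀ (hψpos p hpI)).mpr hp) (hψpos x hx)
  refine ⟨fun x hx hxp => (hstrict x hx hxp).mono fun _ h => h.2, fun hopt => ?_⟩
  obtain ⟨x, hlx, hxp⟩ := exists_between hpstar.1
  have hx : x ∈ Ioo l r := ⟨hlx, hxp.trans hpstar.2⟩
  obtain ⟨p, hpI, hp⟩ := (hstrict x hx hxp).exists
  exact (hopt x hx p hpI).not_gt hp
end

section
/- Suppose h(p) ≤ h(p*) for all p ∈ I and that a·g'(x) + (1/2)·σ(x)²·g''(x) ≤ ρ·g(x) for all x ∈ I with x > p* (condition (17): Lg ≤ ρg to the right of p*). Then h is nonincreasing on I ∩ [p*, ∞): for all x, y ∈ I with p* ≤ x ≤ y one has h(x) ≥ h(y). -/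
open Set

/-- A differentiable function that is strictly decreasing wherever it is positive cannot become
positive after having been nonpositive. -/
theorem nonpos_of_deriv_neg_of_pos {u u' : ℝ → ℝ} {z x : ℝ} (hzx : z ≤ x)
    (hu : ∀ t ∈ Icc z x, HasDerivAt u (u' t) t) (hneg : ∀ t ∈ Icc z x, 0 < u t → u' t < 0)
    (hz : u z ≤ 0) : u x ≤ 0 := by
  refine le_of_forall_pos_le_add fun ε hε => ?_
  rw [zero_add]
  exact image_le_of_deriv_right_lt_deriv_boundary (B := fun _ => ε) (B' := fun _ => 0)
    (fun t ht => (hu t ht).continuousAt.continuousWithinAt)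
    (fun t ht => (hu t (Ico_subset_Icc_self ht)).hasDerivWithinAt) (hz.trans hε.le)
    (fun t => hasDerivAt_const t ε)
    (fun t ht h => hneg t (Ico_subset_Icc_self ht) (h ▸ hε)) ⟨hzx, le_rfl⟩

/-- A positive increasing solution of `a ψ' + s ψ'' = ρ ψ` has positive derivative. -/
theorem deriv_pos_of_strictMonoOn_of_ode {l r ρ : ℝ} {a s ψ : ℝ → ℝ} (hρ : 0 < ρ)
    (hψpos : ∀ x ∈ Ioo l r, 0 < ψ x) (hψm : StrictMonoOn ψ (Ioo l r))
    (hode : ∀ x ∈ Ioo l r, a x * deriv ψ x + s x * deriv (deriv ψ) x = ρ * ψ x) :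
    ∀ x ∈ Ioo l r, 0 < deriv ψ x := by
  have hnonneg : ∀ x ∈ Ioo l r, 0 ≤ deriv ψ x := fun x hx => by
    rw [← derivWithin_of_isOpen isOpen_Ioo hx]
    exact hψm.monotoneOn.derivWithin_nonneg
  intro x hx
  refine (hnonneg x hx).lt_of_ne' fun h0 => ?_
  have hmin : IsLocalMin (deriv ψ) x := by
    filter_upwards [isOpen_Ioo.mem_nhds hx] with t ht
    exact h0 ▸ hnonneg t ht
  have h := hode x hx
  rw [h0, hmin.deriv_eq_zero] at h
  linarith [mul_pos hρ (hψpos x hx)]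

/-- If `h(p) ≤ h(p*)` on `I` and `Lg(x) = a(x)g'(x) + (1/2)σ(x)²g''(x) ≤ ρg(x)`
for `x ∈ I` with `x > p*`, where `ψ` is the increasing positive solution of
`Lψ = ρψ` on `I`, then `h = g/ψ` is nonincreasing on `I ∩ [p*, ∞)`. -/
theorem stmt_11 (l r : ℝ) (hlr : l < r) (a σ : ℝ → ℝ) (ρ : ℝ) (hρ : 0 < ρ)
    (ψ g : ℝ → ℝ) (pstar : ℝ) (hpstar : pstar ∈ Ioo l r)
    (hψpos : ∀ x ∈ Ioo l r, 0 < ψ x) (hψm : StrictMonoOn ψ (Ioo l r))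
    (hψd : ∀ x ∈ Ioo l r, DifferentiableAt ℝ ψ x)
    (hψd2 : ∀ x ∈ Ioo l r, DifferentiableAt ℝ (deriv ψ) x)
    (hode : ∀ x ∈ Ioo l r,
      a x * deriv ψ x + (1 / 2) * (σ x) ^ 2 * deriv (deriv ψ) x = ρ * ψ x)
    (hgc : ContinuousOn g (Ioo l r))
    (hgd : ∀ x ∈ Ioo l r, pstar < x → DifferentiableAt ℝ g x)
    (hgd2 : ∀ x ∈ Ioo l r, pstar < x → DifferentiableAt ℝ (deriv g) x)
    (hopt : ∀ p ∈ Ioo l r, g p / ψ p ≤ g pstar / ψ pstar)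
    (hLg : ∀ x ∈ Ioo l r, pstar < x →
      a x * deriv g x + (1 / 2) * (σ x) ^ 2 * deriv (deriv g) x ≤ ρ * g x) :
    ∀ x ∈ Ioo l r, ∀ y ∈ Ioo l r, pstar ≤ x → x ≤ y → g y / ψ y ≤ g x / ψ x := by
  have hψ' := deriv_pos_of_strictMonoOn_of_ode (s := fun x => 1 / 2 * σ x ^ 2) hρ hψpos hψm hode
  have hsub : ∀ {x}, x ∈ Ioo pstar r → x ∈ Ioo l r := fun hx => ⟨hpstar.1.trans hx.1, hx.2⟩
  let u : ℝ → ℝ := fun x => deriv g x * ψ x / deriv ψ x - g x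
  let u' : ℝ → ℝ := fun x =>
    ψ x * (deriv (deriv g) x * deriv ψ x - deriv g x * deriv (deriv ψ) x) / deriv ψ x ^ 2
  have hu : ∀ x ∈ Ioo pstar r, HasDerivAt u (u' x) x := fun x hx => by
    have hne := (hψ' x (hsub hx)).ne'
    refine ((((hgd2 x (hsub hx) hx.1).hasDerivAt.fun_mul (hψd x (hsub hx)).hasDerivAt).fun_div
      (hψd2 x (hsub hx)).hasDerivAt hne).fun_sub
        (hgd x (hsub hx) hx.1).hasDerivAt).congr_deriv ?_
    simp only [u']
    field_simp
    ring
  have hu_mul : ∀ x ∈ Ioo pstar r, u x * deriv ψ x = deriv g x * ψ x - g x * deriv ψ x :=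
    fun x hx => by
      have hne := (hψ' x (hsub hx)).ne'
      simp only [u]
      field_simp
  have hneg : ∀ x ∈ Ioo pstar r, 0 < u x → u' x < 0 := fun x hx hux => by
    have hd := hψ' x (hsub hx)
    have hup := mul_pos hρ (mul_pos hux hd)
    have hL := mul_le_mul_of_nonneg_right (hLg x (hsub hx) hx.1) hd.le
    have hO := congrArg (deriv g x * ·) (hode x (hsub hx))
    have key : (1 / 2 * σ x ^ 2) *
        (deriv (deriv g) x * deriv ψ x - deriv g x * deriv (deriv ψ) x) < 0 := by
      rw [hu_mul x hx] at hup
      linarith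
    exact div_neg_of_neg_of_pos
      (mul_neg_of_pos_of_neg (hψpos x (hsub hx)) (neg_of_mul_neg_right key (by positivity)))
      (by positivity)
  have hderiv : ∀ x ∈ Ioo pstar r,
      HasDerivAt (fun x => g x / ψ x) (u x * deriv ψ x / ψ x ^ 2) x := fun x hx => by
    rw [hu_mul x hx]
    exact (hgd x (hsub hx) hx.1).hasDerivAt.div (hψd x (hsub hx)).hasDerivAt
      (hψpos x (hsub hx)).ne'
  have hcont : ContinuousOn (fun x => g x / ψ x) (Ioo l r) :=
    hgc.div (fun x hx => (hψd x hx).continuousAt.continuousWithinAt) fun x hx => (hψpos x hx).ne'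
  have hu_nonpos : ∀ x ∈ Ioo pstar r, u x ≤ 0 := by
    intro x hx
    by_contra! hux
    have hpos : ∀ z ∈ Ioo pstar x, 0 < u z := fun z hz => by
      by_contra! huz
      have hIcc : ∀ t ∈ Icc z x, t ∈ Ioo pstar r := fun t ht =>
        ⟨hz.1.trans_le ht.1, ht.2.trans_lt hx.2⟩
      exact hux.not_ge (nonpos_of_deriv_neg_of_pos hz.2.le (fun t ht => hu t (hIcc t ht))
        (fun t ht => hneg t (hIcc t ht)) huz)
    have hmono : StrictMonoOn (fun x => g x / ψ x) (Icc pstar x) := by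
      refine strictMonoOn_of_deriv_pos (convex_Icc _ _)
        (hcont.mono fun t ht => ⟨hpstar.1.trans_le ht.1, ht.2.trans_lt hx.2⟩) fun t ht => ?_
      rw [interior_Icc] at ht
      have ht' : t ∈ Ioo pstar r := ⟨ht.1, ht.2.trans hx.2⟩
      rw [(hderiv t ht').deriv]
      exact div_pos (mul_pos (hpos t ht) (hψ' t (hsub ht'))) (pow_pos (hψpos t (hsub ht')) 2)
    exact (hopt x (hsub hx)).not_gt
      (hmono (left_mem_Icc.2 hx.1.le) (right_mem_Icc.2 hx.1.le) hx.1)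
  have hanti : AntitoneOn (fun x => g x / ψ x) (Ico pstar r) := by
    refine antitoneOn_of_deriv_nonpos (convex_Ico _ _)
      (hcont.mono fun t ht => ⟨hpstar.1.trans_le ht.1, ht.2⟩) ?_ ?_ <;>
      rw [interior_Ico]
    · exact fun t ht => (hderiv t ht).differentiableAt.differentiableWithinAt
    · intro t ht
      rw [(hderiv t ht).deriv]
      exact div_nonpos_of_nonpos_of_nonneg
        (mul_nonpos_of_nonpos_of_nonneg (hu_nonpos t ht) (hψ' t (hsub ht)).le) (sq_nonneg _)
  exact fun x hx y hy hpx hxy => hanti ⟨hpx, hx.2⟩ ⟨hpx.trans hxy, hy.2⟩ hxy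
end

section
/- Let 0 < δ < 3. Then h(p) = (p−1)³·p^{−δ} + 1 tends to +∞ as p → ∞. Consequently, sup_{p>0} h(p) = +∞, for every x > 0 one has sup_{p>0} V_p(x) = +∞, and there exists no p* ∈ (0, ∞) with h(p) ≤ h(p*) for all p > 0 (no threshold stopping time is optimal, although the free-boundary problem has the solution p* = 1). -/
open Set Filter

/-- Example 1: `h(p) = (p−1)³·p^{−δ} + 1 = g(p)/ψ(p)` for `g(x) = (x−1)³ + x^δ`,
`ψ(x) = x^δ` on `I = (0, ∞)`. -/
noncomputable def hEx (δ : ℝ) (p : ℝ) : ℝ := (p - 1) ^ 3 * p ^ (-δ) + 1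

/-- Example 1 threshold value: `V_p(x) = h(p)·x^δ` for `x < p`, `g(x)` for `x ≥ p`. -/
noncomputable def VEx (δ : ℝ) (p x : ℝ) : ℝ :=
  if x < p then hEx δ p * x ^ δ else (x - 1) ^ 3 + x ^ δ

theorem tendsto_hEx_atTop {δ : ℝ} (hδ : δ < 3) : Tendsto (hEx δ) atTop atTop := by
  have hpow : Tendsto (fun p : ℝ => p ^ (3 - δ) / 8) atTop atTop :=
    (tendsto_rpow_atTop (sub_pos.2 hδ)).atTop_div_const (by norm_num)
  refine tendsto_atTop_mono' _ ?_ hpow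
  filter_upwards [eventually_ge_atTop (2 : ℝ)] with p hp
  have hp0 : 0 < p := by linarith
  have hsplit : p ^ (3 - δ) = p ^ 3 * p ^ (-δ) := by
    rw [sub_eq_add_neg, Real.rpow_add hp0]
    norm_cast
  have hcube : (p / 2) ^ 3 ≤ (p - 1) ^ 3 := by
    gcongr
    linarith
  have hmul := mul_le_mul_of_nonneg_right hcube (Real.rpow_nonneg hp0.le (-δ))
  rw [hEx, hsplit]
  linarith

theorem tendsto_VEx_atTop {δ x : ℝ} (hδ : δ < 3) (hx : 0 < x) :
    Tendsto (fun p => VEx δ p x) atTop atTop := by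
  refine ((tendsto_hEx_atTop hδ).atTop_mul_const (Real.rpow_pos_of_pos hx δ)).congr' ?_
  filter_upwards [eventually_gt_atTop x] with p hp
  rw [VEx, if_pos hp]

theorem not_bddAbove_image_Ioi_of_tendsto_atTop {f : ℝ → ℝ} (hf : Tendsto f atTop atTop)
    (a : ℝ) : ¬ BddAbove (f '' Ioi a) := by
  rintro ⟨M, hM⟩
  obtain ⟨p, hMp, hp⟩ := ((hf.eventually_gt_atTop M).and (eventually_gt_atTop a)).exists
  exact hMp.not_ge (hM (mem_image_of_mem f hp))

/-- For `0 < δ < 3`, `h(p) → +∞` as `p → ∞`; hence `sup_{p>0} h(p) = +∞`, for every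
`x > 0` one has `sup_{p>0} V_p(x) = +∞`, and no threshold `p* ∈ (0, ∞)` maximizes `h`
(no threshold stopping time is optimal). -/
theorem stmt_12 (δ : ℝ) (hδ0 : 0 < δ) (hδ3 : δ < 3) :
    Tendsto (hEx δ) atTop atTop ∧
      ¬ BddAbove (hEx δ '' Ioi 0) ∧
      (∀ x ∈ Ioi (0 : ℝ), ¬ BddAbove ((fun p => VEx δ p x) '' Ioi 0)) ∧
      ¬ ∃ pstar ∈ Ioi (0 : ℝ), ∀ p ∈ Ioi (0 : ℝ), hEx δ p ≤ hEx δ pstar := by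
  have hlim := tendsto_hEx_atTop hδ3
  have hunbdd := not_bddAbove_image_Ioi_of_tendsto_atTop hlim 0
  refine ⟨hlim, hunbdd, fun x hx =>
    not_bddAbove_image_Ioi_of_tendsto_atTop (tendsto_VEx_atTop hδ3 hx) 0, ?_⟩
  rintro ⟨pstar, -, hmax⟩
  exact hunbdd ⟨hEx δ pstar, forall_mem_image.2 hmax⟩
end

section
/- Let δ > 3 and set p_δ = δ/(δ−3). Then h(p) = (p−1)³·p^{−δ} + 1 is strictly increasing on (0, p_δ] and strictly decreasing on [p_δ, ∞); in particular h(p) < h(p_δ) for every p > 0 with p ≠ p_δ. Consequently, V_p(x) ≤ V_{p_δ}(x) for all x, p ∈ (0, ∞): the threshold p_δ is optimal over all threshold stopping times (while the other free-boundary solution p* = 1 is not). -/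
open Set Filter

theorem hasDerivAt_hEx (δ : ℝ) {p : ℝ} (hp : 0 < p) :
    HasDerivAt (hEx δ) (p ^ (-δ - 1) * (p - 1) ^ 2 * (δ - (δ - 3) * p)) p := by
  have hpow : p ^ (-δ) = p ^ (-δ - 1) * p := by
    rw [← Real.rpow_add_one hp.ne', sub_add_cancel]
  have h := (((hasDerivAt_id p).sub_const 1).pow 3).mul
    (Real.hasDerivAt_rpow_const (p := -δ) (Or.inl hp.ne')) |>.add_const 1
  refine h.congr_deriv ?_
  simp only [id, Pi.pow_apply, hpow]
  push_cast
  ring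

theorem continuousOn_hEx (δ : ℝ) : ContinuousOn (hEx δ) (Ioi 0) := fun _ hp =>
  (hasDerivAt_hEx δ hp).continuousAt.continuousWithinAt

theorem one_lt_threshold {δ : ℝ} (hδ : 3 < δ) : 1 < δ / (δ - 3) := by
  rw [one_lt_div (by linarith)]
  linarith

theorem deriv_hEx_pos {δ p : ℝ} (hδ : 3 < δ) (hp : 0 < p) (hp1 : p ≠ 1)
    (hlt : p < δ / (δ - 3)) : 0 < deriv (hEx δ) p := by
  rw [(hasDerivAt_hEx δ hp).deriv]
  have h1 : 0 < (p - 1) ^ 2 := by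
    have := sub_ne_zero.2 hp1
    positivity
  rw [lt_div_iff₀ (by linarith)] at hlt
  exact mul_pos (mul_pos (Real.rpow_pos_of_pos hp _) h1) (by linarith)

theorem strictMonoOn_hEx {δ : ℝ} (hδ : 3 < δ) :
    StrictMonoOn (hEx δ) (Ioc 0 (δ / (δ - 3))) := by
  have h1 := one_lt_threshold hδ
  have hl : StrictMonoOn (hEx δ) (Ioc 0 1) := by
    refine strictMonoOn_of_deriv_pos (convex_Ioc 0 1)
      ((continuousOn_hEx δ).mono fun p hp => hp.1) fun p hp => ?_
    rw [interior_Ioc] at hp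
    exact deriv_hEx_pos hδ hp.1 hp.2.ne (hp.2.trans h1)
  have hr : StrictMonoOn (hEx δ) (Icc 1 (δ / (δ - 3))) := by
    refine strictMonoOn_of_deriv_pos (convex_Icc 1 _)
      ((continuousOn_hEx δ).mono fun p hp => one_pos.trans_le hp.1) fun p hp => ?_
    rw [interior_Icc] at hp
    exact deriv_hEx_pos hδ (one_pos.trans hp.1) hp.1.ne' hp.2
  rw [← Ioc_union_Icc_eq_Ioc one_pos h1.le]
  exact hl.union hr (isGreatest_Ioc one_pos) (isLeast_Icc h1.le)

theorem strictAntiOn_hEx {δ : ℝ} (hδ : 3 < δ) :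
    StrictAntiOn (hEx δ) (Ici (δ / (δ - 3))) := by
  have h1 := one_lt_threshold hδ
  refine strictAntiOn_of_deriv_neg (convex_Ici _)
    ((continuousOn_hEx δ).mono fun p hp => (one_pos.trans h1).trans_le hp) fun p hp => ?_
  rw [interior_Ici, mem_Ioi] at hp
  have hp1 : 1 < p := h1.trans hp
  have hp0 : 0 < p := one_pos.trans hp1
  rw [(hasDerivAt_hEx δ hp0).deriv]
  rw [div_lt_iff₀ (by linarith)] at hp
  exact mul_neg_of_pos_of_neg
    (mul_pos (Real.rpow_pos_of_pos hp0 _) (pow_pos (sub_pos.2 hp1) 2)) (by linarith)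

theorem hEx_lt_threshold {δ p : ℝ} (hδ : 3 < δ) (hp : 0 < p) (hne : p ≠ δ / (δ - 3)) :
    hEx δ p < hEx δ (δ / (δ - 3)) := by
  have h0 : 0 < δ / (δ - 3) := one_pos.trans (one_lt_threshold hδ)
  rcases hne.lt_or_gt with h | h
  · exact strictMonoOn_hEx hδ ⟨hp, h.le⟩ ⟨h0, le_rfl⟩ h
  · exact strictAntiOn_hEx hδ (mem_Ici.2 le_rfl) (mem_Ici.2 h.le) h

theorem VEx_eq_hEx_max_mul (δ p : ℝ) {x : ℝ} (hx : 0 < x) :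
    VEx δ p x = hEx δ (max p x) * x ^ δ := by
  unfold VEx
  split_ifs with h
  · rw [max_eq_left h.le]
  · rw [max_eq_right (not_lt.1 h), hEx, add_mul, mul_assoc, ← Real.rpow_add hx]
    simp

theorem VEx_le_threshold {δ p x : ℝ} (hδ : 3 < δ) (hx : 0 < x) :
    VEx δ p x ≤ VEx δ (δ / (δ - 3)) x := by
  rw [VEx_eq_hEx_max_mul δ p hx, VEx_eq_hEx_max_mul δ _ hx]
  refine mul_le_mul_of_nonneg_right ?_ (Real.rpow_nonneg hx.le δ)
  rcases le_total x (δ / (δ - 3)) with h | h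
  · rw [max_eq_left h]
    rcases eq_or_ne (max p x) (δ / (δ - 3)) with he | he
    · rw [he]
    · exact (hEx_lt_threshold hδ (lt_max_of_lt_right hx) he).le
  · rw [max_eq_right h]
    exact (strictAntiOn_hEx hδ).antitoneOn (mem_Ici.2 h)
      (mem_Ici.2 (h.trans (le_max_right p x))) (le_max_right p x)

/-- For `δ > 3` and `p_δ = δ/(δ−3)`: `h` is strictly increasing on `(0, p_δ]` and
strictly decreasing on `[p_δ, ∞)`, so `h(p) < h(p_δ)` for `p ≠ p_δ`; consequently
`V_p(x) ≤ V_{p_δ}(x)` for all `x, p > 0`, i.e. the threshold `p_δ` is optimal over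
all threshold stopping times. -/
theorem stmt_15 (δ : ℝ) (hδ : 3 < δ) :
    StrictMonoOn (hEx δ) (Ioc 0 (δ / (δ - 3))) ∧
      StrictAntiOn (hEx δ) (Ici (δ / (δ - 3))) ∧
      (∀ p ∈ Ioi (0 : ℝ), p ≠ δ / (δ - 3) → hEx δ p < hEx δ (δ / (δ - 3))) ∧
      ∀ x ∈ Ioi (0 : ℝ), ∀ p ∈ Ioi (0 : ℝ), VEx δ p x ≤ VEx δ (δ / (δ - 3)) x := by
  exact ⟨strictMonoOn_hEx hδ, strictAntiOn_hEx hδ, fun _ hp hne => hEx_lt_threshold hδ hp hne,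
    fun _ hx _ _ => VEx_le_threshold hδ hx⟩
end
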